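/- Let I be a finite index set with positive weights |Q_i| > 0, let ε > 0, m > 1 and h(r) = r^m. Define KL(g|ω) = Σ_{i,j} |Q_i||Q_j|·[g_{ij}(log g_{ij} − log ω_{ij}) − g_{ij} + ω_{ij}] for nonnegative matrices (with 0·log 0 = 0, and the (i,j)-term equal to +∞ if ω_{ij}=0<g_{ij}). Let ω be a nonnegative matrix with column sums η_j := Σ_i |Q_i|ω_{ij} > 0 for all j. Then for each j there is a unique z_j ≥ 0 solving H_ε(z_j) := z_j·exp(h'(z_j)/ε) = η_j, and the unique minimizer of g ↦ ε·KL(g|ω) + Σ_j |Q_j|·h(Σ_i |Q_i| g_{ij}) over nonnegative matrices g is the column rescaling g_{ij} = ω_{ij}·z_j/η_j; its column sums equal Σ_i |Q_i| g_{ij} = z_j. -/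

import Mathlib

open scoped BigOperators

noncomputable section


lemma aux_D (g u : ℝ) (hg : 0 ≤ g) (hu : 0 < u) :
    0 ≤ g * (Real.log g - Real.log u) - g + u ∧
    (g ≠ u → 0 < g * (Real.log g - Real.log u) - g + u) := by
  have key : g ≠ u → 0 < g * (Real.log g - Real.log u) - g + u := by
    intro hne
    rcases hg.eq_or_lt with h0 | hpos
    · rw [← h0]; simpa using hu
    · have h1 : u / g ≠ 1 := by
        intro h
        rw [div_eq_one_iff_eq hpos.ne'] at h
        exact hne h.symm
      have h2 := Real.log_lt_sub_one_of_pos (div_pos hu hpos) h1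
      rw [Real.log_div hu.ne' hpos.ne'] at h2
      have h3 := mul_lt_mul_of_pos_left h2 hpos
      have h4 : g * (u / g - 1) = u - g := by field_simp
      linarith
  refine ⟨?_, key⟩
  by_cases h : g = u
  · subst h; simp
  · exact (key h).le

lemma aux_bern (m G z : ℝ) (hm : 1 < m) (hG : 0 ≤ G) (hz : 0 < z) :
    z ^ m + m * z ^ (m - 1) * (G - z) ≤ G ^ m := by
  have hs : -1 ≤ G / z - 1 := by
    have : 0 ≤ G / z := by positivity
    linarith
  have h := one_add_mul_self_le_rpow_one_add hs hm.le
  have e1 : 1 + (G / z - 1) = G / z := by ring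
  rw [e1, Real.div_rpow hG hz.le, le_div_iff₀ (by positivity)] at h
  have e2 : z ^ m = z ^ (m - 1) * z := by
    rw [Real.rpow_sub_one hz.ne']; field_simp
  calc z ^ m + m * z ^ (m - 1) * (G - z) = (1 + m * (G / z - 1)) * z ^ m := by
        rw [e2]; field_simp
    _ ≤ _ := h

lemma aux_mono (ε m : ℝ) (hε : 0 < ε) (hm : 1 < m) (a b : ℝ) (ha : 0 ≤ a) (hab : a < b) :
    a * Real.exp (m * a ^ (m - 1) / ε) < b * Real.exp (m * b ^ (m - 1) / ε) := by
  have h1 : a ^ (m - 1) < b ^ (m - 1) := Real.rpow_lt_rpow ha hab (by linarith)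
  have h2 : Real.exp (m * a ^ (m - 1) / ε) < Real.exp (m * b ^ (m - 1) / ε) := by
    apply Real.exp_lt_exp.2
    gcongr
  exact mul_lt_mul'' hab h2 ha (Real.exp_pos _).le

lemma aux_exist (ε m : ℝ) (hε : 0 < ε) (hm : 1 < m) (η : ℝ) (hη : 0 < η) :
    ∃ z, 0 < z ∧ z * Real.exp (m * z ^ (m - 1) / ε) = η := by
  have hc : Continuous fun z : ℝ => z * Real.exp (m * z ^ (m - 1) / ε) := by
    have : Continuous fun z : ℝ => z ^ (m - 1) :=
      Real.continuous_rpow_const (by linarith)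
    fun_prop
  have h := intermediate_value_Icc hη.le hc.continuousOn
  have hmem : η ∈ Set.Icc ((fun z : ℝ => z * Real.exp (m * z ^ (m - 1) / ε)) 0)
      ((fun z : ℝ => z * Real.exp (m * z ^ (m - 1) / ε)) η) := by
    constructor
    · simpa using hη.le
    · have : 1 ≤ Real.exp (m * η ^ (m - 1) / ε) := Real.one_le_exp (by positivity)
      simpa using le_mul_of_one_le_right hη.le this
  obtain ⟨z, hz, hz2⟩ := h hmem
  refine ⟨z, lt_of_le_of_ne hz.1 ?_, hz2⟩
  rintro rfl
  simp at hz2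
  exact hη.ne hz2

def kk (a b : ℝ) : ℝ := if b = 0 then 0 else a * (Real.log a - Real.log b) - a + b

lemma aux_kk (ε c t o g : ℝ) (hε : 0 < ε) (ht : 0 < t) (hlog : Real.log t = - c / ε)
    (ho : 0 ≤ o) (hg : 0 ≤ g) (h0 : o = 0 → g = 0) :
    ε * kk (o * t) o - c * (g - o * t) ≤ ε * kk g o ∧
    (g ≠ o * t → ε * kk (o * t) o - c * (g - o * t) < ε * kk g o) := by
  rcases ho.eq_or_lt with h | h
  · have hg0 := h0 h.symm
    subst h; subst hg0; simp [kk]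
  · have hid : ε * kk g o - (ε * kk (o * t) o - c * (g - o * t)) =
        ε * (g * (Real.log g - Real.log (o * t)) - g + o * t) := by
      simp only [kk, h.ne', if_false]
      rw [Real.log_mul h.ne' ht.ne', hlog]
      field_simp
      ring
    have hD := aux_D g (o * t) hg (by positivity)
    refine ⟨?_, fun hne => ?_⟩
    · have := mul_nonneg hε.le hD.1
      linarith
    · have := mul_pos hε (hD.2 hne)
      linarith

lemma aux_coe_sum {I : Type} (s : Finset I) (f : I → ℝ) :
    ((∑ i ∈ s, f i : ℝ) : EReal) = ∑ i ∈ s, (f i : EReal) := by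
  classical
  induction s using Finset.induction_on with
  | empty => simp
  | insert a s ha ih => rw [Finset.sum_insert ha, Finset.sum_insert ha, EReal.coe_add, ih]

lemma aux_ne_bot {I : Type} (s : Finset I) (f : I → EReal) (h : ∀ i ∈ s, f i ≠ ⊥) :
    ∑ i ∈ s, f i ≠ ⊥ := by
  classical
  induction s using Finset.induction_on with
  | empty => simp
  | insert a s ha ih =>
    rw [Finset.sum_insert ha]
    intro hb
    rcases EReal.add_eq_bot_iff.1 hb with h1 | h1
    · exact h a (by simp) h1
    · exact ih (fun i hi => h i (by simp [hi])) h1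

lemma aux_top {I : Type} (s : Finset I) (f : I → EReal) (h : ∀ i ∈ s, f i ≠ ⊥) (a : I)
    (ha : a ∈ s) (hf : f a = ⊤) : ∑ i ∈ s, f i = ⊤ := by
  classical
  rw [← Finset.add_sum_erase s f ha, hf]
  exact EReal.top_add_of_ne_bot (aux_ne_bot _ _ fun i hi => h i (Finset.mem_of_mem_erase hi))

/-- The first partial minimization step of Dykstra's algorithm for the
entropically regularized JKO scheme with `h(r) = r^m`: for each `j` there is a unique `z_j ≥ 0`
with `H_ε(z_j) := z_j·exp(h'(z_j)/ε) = η_j` (`η_j = Σ_i |Q_i| ω_{ij}` the column sums of `ω`),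
and the unique minimizer of `g ↦ ε·KL(g|ω) + Σ_j |Q_j| h(Σ_i |Q_i| g_{ij})` over nonnegative
matrices is the column rescaling `g_{ij} = ω_{ij}·z_j/η_j`, whose column sums equal `z_j`. -/
theorem statement19 (I : Type) [Fintype I] (w : I → ℝ) (hw : ∀ i, 0 < w i)
    (ε m : ℝ) (hε : 0 < ε) (hm : 1 < m)
    (ω : I → I → ℝ) (hω : ∀ i j, 0 ≤ ω i j)
    (η : I → ℝ) (hη : ∀ j, η j = ∑ i, w i * ω i j) (hηpos : ∀ j, 0 < η j)
    (KL : (I → I → ℝ) → (I → I → ℝ) → EReal)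
    (hKL : ∀ g ω' : I → I → ℝ, KL g ω' = ∑ i, ∑ j, ((w i * w j : ℝ) : EReal) *
      (if ω' i j = 0 then (if g i j = 0 then (0 : EReal) else (⊤ : EReal))
       else ((g i j * (Real.log (g i j) - Real.log (ω' i j)) - g i j + ω' i j : ℝ) : EReal))) :
    ∃ z : I → ℝ,
      (∀ j, 0 ≤ z j ∧ z j * Real.exp (m * z j ^ (m - 1) / ε) = η j ∧
        ∀ z' : ℝ, 0 ≤ z' → z' * Real.exp (m * z' ^ (m - 1) / ε) = η j → z' = z j) ∧
      (∀ j, ∑ i, w i * (ω i j * z j / η j) = z j) ∧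
      ∀ g : I → I → ℝ, (∀ i j, 0 ≤ g i j) →
        ((ε : EReal) * KL (fun i j => ω i j * z j / η j) ω
            + ((∑ j, w j * (∑ i, w i * (ω i j * z j / η j)) ^ m : ℝ) : EReal)
          ≤ (ε : EReal) * KL g ω + ((∑ j, w j * (∑ i, w i * g i j) ^ m : ℝ) : EReal)) ∧
        (g ≠ (fun i j => ω i j * z j / η j) →
          (ε : EReal) * KL (fun i j => ω i j * z j / η j) ω
              + ((∑ j, w j * (∑ i, w i * (ω i j * z j / η j)) ^ m : ℝ) : EReal)
            < (ε : EReal) * KL g ω + ((∑ j, w j * (∑ i, w i * g i j) ^ m : ℝ) : EReal)) := by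
  classical
  have hKLreal : ∀ g : I → I → ℝ, (∀ i j, ω i j = 0 → g i j = 0) →
      KL g ω = ((∑ i, ∑ j, w i * w j * kk (g i j) (ω i j) : ℝ) : EReal) := by
    intro g hg
    rw [hKL, aux_coe_sum]
    refine Finset.sum_congr rfl fun i _ => ?_
    rw [aux_coe_sum]
    refine Finset.sum_congr rfl fun j _ => ?_
    rw [EReal.coe_mul (w i * w j)]
    congr 1
    by_cases h : ω i j = 0
    · simp [kk, h, hg i j h]
    · simp only [kk, h, if_false]
  have hKLtop : ∀ g : I → I → ℝ, (∃ i j, ω i j = 0 ∧ g i j ≠ 0) → KL g ω = ⊤ := by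
    rintro g ⟨i, j, h1, h2⟩
    have hnb : ∀ i j, ((w i * w j : ℝ) : EReal) *
      (if ω i j = 0 then (if g i j = 0 then (0 : EReal) else (⊤ : EReal))
       else ((g i j * (Real.log (g i j) - Real.log (ω i j)) - g i j + ω i j : ℝ) : EReal))
        ≠ ⊥ := by
      intro i j
      split_ifs
      · simp
      · rw [EReal.coe_mul_top_of_pos (mul_pos (hw i) (hw j))]; simp
      · rw [← EReal.coe_mul]; exact EReal.coe_ne_bot _
    rw [hKL]
    refine aux_top _ _ (fun i _ => aux_ne_bot _ _ fun j _ => hnb i j) i (Finset.mem_univ _) ?_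
    refine aux_top _ _ (fun j _ => hnb i j) j (Finset.mem_univ _) ?_
    rw [if_pos h1, if_neg h2, EReal.coe_mul_top_of_pos (mul_pos (hw i) (hw j))]
  choose z hzpos hz using fun j => aux_exist ε m hε hm (η j) (hηpos j)
  have hcol : ∀ j, ∑ i, w i * (ω i j * z j / η j) = z j := by
    intro j
    have : ∑ i, w i * (ω i j * z j / η j) = (∑ i, w i * ω i j) * (z j / η j) := by
      rw [Finset.sum_mul]
      exact Finset.sum_congr rfl fun i _ => by ring
    rw [this, ← hη]
    have := (hηpos j).ne'
    field_simp
  have hlog : ∀ j, Real.log (z j / η j) = - (m * z j ^ (m - 1)) / ε := by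
    intro j
    rw [Real.log_div (hzpos j).ne' (hηpos j).ne', ← hz j,
      Real.log_mul (hzpos j).ne' (Real.exp_pos _).ne', Real.log_exp]
    ring
  refine ⟨z, fun j => ⟨(hzpos j).le, hz j, ?_⟩, hcol, ?_⟩
  · intro z' h0 h
    rcases lt_trichotomy z' (z j) with hl | hl | hl
    · have := aux_mono ε m hε hm _ _ h0 hl
      rw [h, hz] at this
      exact absurd this (lt_irrefl _)
    · exact hl
    · have := aux_mono ε m hε hm _ _ (hzpos j).le hl
      rw [h, hz] at this
      exact absurd this (lt_irrefl _)
  intro g hg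
  have main : g ≠ (fun i j => ω i j * z j / η j) →
          (ε : EReal) * KL (fun i j => ω i j * z j / η j) ω
              + ((∑ j, w j * (∑ i, w i * (ω i j * z j / η j)) ^ m : ℝ) : EReal)
            < (ε : EReal) * KL g ω + ((∑ j, w j * (∑ i, w i * g i j) ^ m : ℝ) : EReal) := by
    intro hne
    rw [hKLreal (fun i j => ω i j * z j / η j) (fun i j h => by simp [h]), ← EReal.coe_mul,
      ← EReal.coe_add]
    by_cases hex : ∃ i j, ω i j = 0 ∧ g i j ≠ 0
    · rw [hKLtop g hex, EReal.coe_mul_top_of_pos hε, EReal.top_add_coe]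
      exact EReal.coe_lt_top _
    have hex' : ∀ i j, ω i j = 0 → g i j = 0 := by
      intro i j h
      by_contra h2
      exact hex ⟨i, j, h, h2⟩
    rw [hKLreal g hex', ← EReal.coe_mul, ← EReal.coe_add, EReal.coe_lt_coe_iff]
    have hre : ∀ f : I → I → ℝ, ε * (∑ i, ∑ j, w i * w j * kk (f i j) (ω i j))
        + ∑ j, w j * (∑ i, w i * f i j) ^ m =
        ∑ j, w j * (∑ i, w i * (ε * kk (f i j) (ω i j)) + (∑ i, w i * f i j) ^ m) := by
      intro f
      rw [Finset.sum_comm, Finset.mul_sum, ← Finset.sum_add_distrib]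
      refine Finset.sum_congr rfl fun j _ => ?_
      rw [mul_add, Finset.mul_sum, Finset.mul_sum]
      congr 1
      exact Finset.sum_congr rfl fun i _ => by ring
    rw [hre g, hre (fun i j => ω i j * z j / η j)]
    have hk : ∀ i j, ε * kk (ω i j * z j / η j) (ω i j)
          - (m * z j ^ (m - 1)) * (g i j - ω i j * z j / η j) ≤ ε * kk (g i j) (ω i j) ∧
        (g i j ≠ ω i j * z j / η j → ε * kk (ω i j * z j / η j) (ω i j)
          - (m * z j ^ (m - 1)) * (g i j - ω i j * z j / η j) < ε * kk (g i j) (ω i j)) := by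
      intro i j
      have := aux_kk ε (m * z j ^ (m - 1)) (z j / η j) (ω i j) (g i j) hε
        (div_pos (hzpos j) (hηpos j)) (hlog j) (hω i j) (hg i j) (hex' i j)
      rwa [← mul_div_assoc] at this
    have hsum : ∀ j, ∑ i, w i * (ε * kk (ω i j * z j / η j) (ω i j)
          - (m * z j ^ (m - 1)) * (g i j - ω i j * z j / η j)) =
        ∑ i, w i * (ε * kk (ω i j * z j / η j) (ω i j))
          - m * z j ^ (m - 1) * (∑ i, w i * g i j - z j) := by
      intro j
      have hz' : ∑ i, w i * g i j - z j
          = ∑ i, w i * g i j - ∑ i, w i * (ω i j * z j / η j) := by rw [hcol j]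
      rw [hz', ← Finset.sum_sub_distrib, Finset.mul_sum, ← Finset.sum_sub_distrib]
      exact Finset.sum_congr rfl fun i _ => by ring
    have hb : ∀ j, z j ^ m + m * z j ^ (m - 1) * (∑ i, w i * g i j - z j)
        ≤ (∑ i, w i * g i j) ^ m := fun j => aux_bern m _ (z j) hm
          (Finset.sum_nonneg fun i _ => mul_nonneg (hw i).le (hg i j)) (hzpos j)
    obtain ⟨i0, j0, hij⟩ : ∃ i j, g i j ≠ ω i j * z j / η j := by
      by_contra hcon
      push Not at hcon
      exact hne (funext fun i => funext fun j => hcon i j)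
    refine Finset.sum_lt_sum (fun j _ => ?_) ⟨j0, Finset.mem_univ _, ?_⟩
    · refine mul_le_mul_of_nonneg_left ?_ (hw j).le
      have h1 := Finset.sum_le_sum fun i (_ : i ∈ Finset.univ) =>
        mul_le_mul_of_nonneg_left (hk i j).1 (hw i).le
      rw [hsum] at h1
      rw [hcol]
      linarith [hb j]
    · refine mul_lt_mul_of_pos_left ?_ (hw j0)
      have h1 := Finset.sum_lt_sum (fun i (_ : i ∈ Finset.univ) =>
        mul_le_mul_of_nonneg_left (hk i j0).1 (hw i).le)
        ⟨i0, Finset.mem_univ _, mul_lt_mul_of_pos_left ((hk i0 j0).2 hij) (hw i0)⟩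
      rw [hsum] at h1
      rw [hcol]
      linarith [hb j0]
  refine ⟨?_, main⟩
  by_cases h : g = (fun i j => ω i j * z j / η j)
  · rw [h]
  · exact (main h).le
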